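/- arXiv:1311.4932 — 2 statements merged into one kernel-verified Lean document; each statement's English description precedes it below -/
import Mathlib

section
/- There exists C₀ > 0, independent of λ, A and Â, such that for every λ ≥ 1, all invertible linear maps A : ℝ^d → ℝ^d and Â : ℝ^{d'} → ℝ^{d'} with ‖A⁻¹‖ < 1/λ and ‖Â‖ < 1/λ, and every x ∈ ℝ^{2(d+d')} with x ≠ 0, one has W^r(L x) ≤ C₀ · max( λ^{−r} · W^r(x), 1 ), where L := (A⊕Â⁻¹) ⊕ ((A⊕Â⁻¹)ᵀ)⁻¹ acts by A⊕Â⁻¹ on the (ζ_p,ξ̃_y)-component and by ((A⊕Â⁻¹)ᵀ)⁻¹ on the (ζ_q,ỹ)-component. (This is the basic contraction property of the anisotropic weight W^r under hyperbolic canonical maps; in particular W^r(Lx) ≤ C₀ λ^{−r} W^r(x) at all points where λ^{−r} W^r(x) ≥ 1.) -/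
noncomputable section

/-- Squared Euclidean norm on `ℝ^n`. -/
def nsq {n : ℕ} (a : Fin n → ℝ) : ℝ := ∑ i, (a i) ^ 2

/-- Squared Euclidean norm on `ℝ^{d+d'} = ℝ^d × ℝ^{d'}`. -/
def nsqH {d d' : ℕ} (a : (Fin d → ℝ) × (Fin d' → ℝ)) : ℝ := nsq a.1 + nsq a.2

/-- Squared Euclidean norm on `ℝ^{2(d+d')}`, written as pairs
`x = ((ζ_p,ξ̃_y),(ζ_q,ỹ))`. -/
def nsqX {d d' : ℕ}
    (x : ((Fin d → ℝ) × (Fin d' → ℝ)) × ((Fin d → ℝ) × (Fin d' → ℝ))) : ℝ :=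
  nsqH x.1 + nsqH x.2

/-- The anisotropic weight `W^r(x) = ⟨|x|⟩^{r·ord(x)}`. -/
def weightW (d d' : ℕ) (r : ℝ) (jap : ℝ → ℝ)
    (ord : ((Fin d → ℝ) × (Fin d' → ℝ)) × ((Fin d → ℝ) × (Fin d' → ℝ)) → ℝ)
    (x : ((Fin d → ℝ) × (Fin d' → ℝ)) × ((Fin d → ℝ) × (Fin d' → ℝ))) : ℝ :=
  jap (Real.sqrt (nsqX x)) ^ (r * ord x)

/-- The hyperbolic linear map `L = (A⊕Â⁻¹) ⊕ ((A⊕Â⁻¹)ᵀ)⁻¹`, acting by `A⊕Â⁻¹` on the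
`(ζ_p,ξ̃_y)`-component and by `(Aᵀ)⁻¹⊕Âᵀ` on the `(ζ_q,ỹ)`-component. -/
def hypMap {d d' : ℕ} (A : Matrix (Fin d) (Fin d) ℝ) (Ah : Matrix (Fin d') (Fin d') ℝ)
    (x : ((Fin d → ℝ) × (Fin d' → ℝ)) × ((Fin d → ℝ) × (Fin d' → ℝ))) :
    ((Fin d → ℝ) × (Fin d' → ℝ)) × ((Fin d → ℝ) × (Fin d' → ℝ)) :=
  ((A.mulVec x.1.1, (Ah⁻¹).mulVec x.1.2),
   ((A.transpose⁻¹).mulVec x.2.1, Ah.transpose.mulVec x.2.2))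

theorem nsq_nonneg {n : ℕ} (a : Fin n → ℝ) : 0 ≤ nsq a :=
  Finset.sum_nonneg fun i _ => sq_nonneg (a i)

theorem nsqH_nonneg {d d' : ℕ} (a : (Fin d → ℝ) × (Fin d' → ℝ)) : 0 ≤ nsqH a :=
  add_nonneg (nsq_nonneg _) (nsq_nonneg _)

theorem nsq_eq_dotProduct {n : ℕ} (a : Fin n → ℝ) : nsq a = a ⬝ᵥ a := by
  simp [nsq, dotProduct, sq]

theorem dotProduct_sq_le_nsq_mul_nsq {n : ℕ} (a b : Fin n → ℝ) :
    (a ⬝ᵥ b) ^ 2 ≤ nsq a * nsq b :=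
  Finset.sum_mul_sq_le_sq_mul_sq _ _ _

/-- An upper bound on a matrix acting on Euclidean space, in squared form. -/
theorem nsq_mulVec_le_of_sqrt_le {n : ℕ} {B : Matrix (Fin n) (Fin n) ℝ} {lam : ℝ}
    (hlam : 1 ≤ lam)
    (h : ∃ c : ℝ, 0 ≤ c ∧ c < 1 / lam ∧
      ∀ v : Fin n → ℝ, Real.sqrt (nsq (B.mulVec v)) ≤ c * Real.sqrt (nsq v))
    (v : Fin n → ℝ) : lam ^ 2 * nsq (B.mulVec v) ≤ nsq v := by
  obtain ⟨c, hc0, hc, h⟩ := h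
  have hl : 0 < lam := by linarith
  have hcl : lam * c ≤ 1 := by
    rw [lt_div_iff₀ hl] at hc
    linarith
  have h1 : lam * Real.sqrt (nsq (B.mulVec v)) ≤ Real.sqrt (nsq v) := by
    calc lam * Real.sqrt (nsq (B.mulVec v)) ≤ lam * (c * Real.sqrt (nsq v)) := by
          gcongr
          exact h v
      _ = (lam * c) * Real.sqrt (nsq v) := by ring
      _ ≤ 1 * Real.sqrt (nsq v) := by gcongr
      _ = Real.sqrt (nsq v) := one_mul _
  have h2 := pow_le_pow_left₀ (by positivity) h1 2
  rwa [mul_pow, Real.sq_sqrt (nsq_nonneg _), Real.sq_sqrt (nsq_nonneg _)] at h2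

/-- A matrix and its transpose satisfy the same operator norm bounds. -/
theorem nsq_transpose_mulVec_le {n : ℕ} {B : Matrix (Fin n) (Fin n) ℝ} {k : ℝ} (hk : 0 ≤ k)
    (h : ∀ v : Fin n → ℝ, k * nsq (B.mulVec v) ≤ nsq v) (v : Fin n → ℝ) :
    k * nsq (B.transpose.mulVec v) ≤ nsq v := by
  set w := B.transpose.mulVec v
  have h1 : nsq w = v ⬝ᵥ B.mulVec w := by
    rw [nsq_eq_dotProduct, Matrix.dotProduct_mulVec, ← Matrix.mulVec_transpose,
      Matrix.transpose_transpose, dotProduct_comm]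
  have h2 := dotProduct_sq_le_nsq_mul_nsq v (B.mulVec w)
  rw [← h1] at h2
  have h3 : nsq w * (k * nsq w) ≤ nsq w * nsq v := by
    calc nsq w * (k * nsq w) = k * nsq w ^ 2 := by ring
      _ ≤ k * (nsq v * nsq (B.mulVec w)) := by gcongr
      _ = nsq v * (k * nsq (B.mulVec w)) := by ring
      _ ≤ nsq v * nsq w := mul_le_mul_of_nonneg_left (h w) (nsq_nonneg v)
      _ = nsq w * nsq v := mul_comm _ _
  rcases (nsq_nonneg w).eq_or_lt with h0 | h0
  · rw [← h0, mul_zero]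
    exact nsq_nonneg v
  · exact le_of_mul_le_mul_left h3 h0

section HyperbolicMap

variable {d d' : ℕ} {A : Matrix (Fin d) (Fin d) ℝ} {Ah : Matrix (Fin d') (Fin d') ℝ} {lam : ℝ}

/-- The hyperbolic map expands the first component by at least `lam`. -/
theorem le_nsqH_hypMap_fst (hA : IsUnit A.det) (hAh : IsUnit Ah.det)
    (h : ∀ v, lam ^ 2 * nsq (A⁻¹.mulVec v) ≤ nsq v)
    (hh : ∀ v, lam ^ 2 * nsq (Ah.mulVec v) ≤ nsq v)
    (x : ((Fin d → ℝ) × (Fin d' → ℝ)) × ((Fin d → ℝ) × (Fin d' → ℝ))) :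
    lam ^ 2 * nsqH x.1 ≤ nsqH (hypMap A Ah x).1 := by
  have h1 := h (A.mulVec x.1.1)
  have h2 := hh ((Ah⁻¹).mulVec x.1.2)
  rw [Matrix.mulVec_mulVec, Matrix.nonsing_inv_mul _ hA, Matrix.one_mulVec] at h1
  rw [Matrix.mulVec_mulVec, Matrix.mul_nonsing_inv _ hAh, Matrix.one_mulVec] at h2
  simp only [nsqH, hypMap]
  linarith

/-- The hyperbolic map contracts the second component by at least `lam`. -/
theorem nsqH_hypMap_snd_le
    (h : ∀ v, lam ^ 2 * nsq (A⁻¹.mulVec v) ≤ nsq v)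
    (hh : ∀ v, lam ^ 2 * nsq (Ah.mulVec v) ≤ nsq v)
    (x : ((Fin d → ℝ) × (Fin d' → ℝ)) × ((Fin d → ℝ) × (Fin d' → ℝ))) :
    lam ^ 2 * nsqH (hypMap A Ah x).2 ≤ nsqH x.2 := by
  have h1 := nsq_transpose_mulVec_le (sq_nonneg lam) h x.2.1
  have h2 := nsq_transpose_mulVec_le (sq_nonneg lam) hh x.2.2
  rw [Matrix.transpose_nonsing_inv] at h1
  simp only [nsqH, hypMap]
  linarith

theorem hypMap_ne_zero (hA : IsUnit A.det) (hAh : IsUnit Ah.det)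
    {x : ((Fin d → ℝ) × (Fin d' → ℝ)) × ((Fin d → ℝ) × (Fin d' → ℝ))} (hx : x ≠ 0) :
    hypMap A Ah x ≠ 0 := by
  have key : ∀ {n : ℕ} {B : Matrix (Fin n) (Fin n) ℝ}, IsUnit B.det → ∀ {v : Fin n → ℝ},
      B.mulVec v = 0 → v = 0 := fun hB v hv => by
    have := Matrix.mulVec_injective_of_isUnit ((Matrix.isUnit_iff_isUnit_det _).2 hB)
    exact this (by rw [hv, Matrix.mulVec_zero])
  intro h
  simp only [hypMap, Prod.mk_eq_zero] at h
  obtain ⟨⟨h1, h2⟩, h3, h4⟩ := h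
  refine hx (Prod.ext (Prod.ext (key hA h1) (key ?_ h2)) (Prod.ext (key ?_ h3) (key ?_ h4)))
  · exact Matrix.isUnit_nonsing_inv_det _ hAh
  · exact Matrix.isUnit_nonsing_inv_det _ (by rwa [Matrix.det_transpose])
  · rwa [Matrix.det_transpose]

end HyperbolicMap

/-- A continuous function equal to `|s|` for `|s| ≥ 2` is dominated by `max 1 s` on `s ≥ 0`. -/
theorem exists_le_mul_max_one {jap : ℝ → ℝ} (hcont : Continuous jap)
    (habs : ∀ s : ℝ, 2 ≤ |s| → jap s = |s|) :
    ∃ M : ℝ, 1 ≤ M ∧ ∀ s, 0 ≤ s → jap s ≤ M * max 1 s := by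
  obtain ⟨K, hK⟩ := (isCompact_Icc (a := (0 : ℝ)) (b := 2)).bddAbove_image hcont.continuousOn
  refine ⟨max 1 K, le_max_left _ _, fun s hs => ?_⟩
  have hM : 1 ≤ max 1 K := le_max_left _ _
  have hm : 1 ≤ max 1 s := le_max_left _ _
  rcases le_total s 2 with h | h
  · have h1 : jap s ≤ max 1 K := (hK ⟨s, ⟨hs, h⟩, rfl⟩).trans (le_max_right _ _)
    nlinarith
  · rw [habs s (by rwa [abs_of_nonneg hs]), abs_of_nonneg hs]
    nlinarith [le_max_right 1 s]

/-- Basic contraction property of the anisotropic weight `W^r` under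
hyperbolic canonical maps: there is `C₀ > 0`, independent of `λ`, `A` and `Â`, with
`W^r(Lx) ≤ C₀·max(λ^{−r}·W^r(x), 1)` for all `x ≠ 0`. -/
theorem weight_contraction_under_hyperbolic_map
    (d d' : ℕ) (hd : 1 ≤ d) (r : ℝ) (hr : 0 < r)
    (jap : ℝ → ℝ) (hjap_smooth : ContDiff ℝ (⊤ : ℕ∞) jap) (hjap_one : ∀ s, 1 ≤ jap s)
    (hjap_abs : ∀ s : ℝ, 2 ≤ |s| → jap s = |s|)
    (ord : ((Fin d → ℝ) × (Fin d' → ℝ)) × ((Fin d → ℝ) × (Fin d' → ℝ)) → ℝ)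
    (hord_smooth : ContDiffOn ℝ (⊤ : ℕ∞) ord {x | x ≠ 0})
    (hord_range : ∀ x, x ≠ 0 → -1 ≤ ord x ∧ ord x ≤ 1)
    (hord_homog : ∀ (c : ℝ), 0 < c → ∀ x, ord (c • x) = ord x)
    (hord_minus : ∀ x, x ≠ 0 → Real.sqrt (nsqH x.2) ≤ 2⁻¹ * Real.sqrt (nsqH x.1) →
      ord x = -1)
    (hord_plus : ∀ x, x ≠ 0 → Real.sqrt (nsqH x.1) ≤ 2⁻¹ * Real.sqrt (nsqH x.2) →
      ord x = 1)
    (hord_mono : ∀ x x', x ≠ 0 → x' ≠ 0 →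
      Real.sqrt (nsqH x'.2) * Real.sqrt (nsqH x.1)
        ≤ Real.sqrt (nsqH x.2) * Real.sqrt (nsqH x'.1) →
      ord x' ≤ ord x) :
    ∃ C₀ : ℝ, 0 < C₀ ∧
      ∀ lam : ℝ, 1 ≤ lam →
      ∀ (A : Matrix (Fin d) (Fin d) ℝ) (Ah : Matrix (Fin d') (Fin d') ℝ),
        IsUnit A.det → IsUnit Ah.det →
        (∃ c : ℝ, 0 ≤ c ∧ c < 1 / lam ∧
          ∀ ζ : Fin d → ℝ, Real.sqrt (nsq (A⁻¹.mulVec ζ)) ≤ c * Real.sqrt (nsq ζ)) →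
        (∃ c : ℝ, 0 ≤ c ∧ c < 1 / lam ∧
          ∀ η : Fin d' → ℝ, Real.sqrt (nsq (Ah.mulVec η)) ≤ c * Real.sqrt (nsq η)) →
        ∀ x, x ≠ 0 →
          weightW d d' r jap ord (hypMap A Ah x)
            ≤ C₀ * max (lam ^ (-r) * weightW d d' r jap ord x) 1 := by
  obtain ⟨M, hM, hjM⟩ := exists_le_mul_max_one hjap_smooth.continuous hjap_abs
  have hj2 : ∀ s, 0 ≤ s → s ≤ 2 * jap s := fun s hs => by
    rcases le_total s 2 with h | h
    · linarith [hjap_one s]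
    · rw [hjap_abs s (by rwa [abs_of_nonneg hs]), abs_of_nonneg hs]
      linarith
  refine ⟨(12 * M) ^ r, by positivity, ?_⟩
  intro lam hlam A Ah hA hAh hcA hcAh x hx
  have hl : 0 < lam := by linarith
  have hbA := nsq_mulVec_le_of_sqrt_le hlam hcA
  have hbAh := nsq_mulVec_le_of_sqrt_le hlam hcAh
  have hfst := le_nsqH_hypMap_fst hA hAh hbA hbAh x
  have hsnd := nsqH_hypMap_snd_le hbA hbAh x
  have hy := hypMap_ne_zero hA hAh hx
  set y := hypMap A Ah x
  have hx1 := nsqH_nonneg x.1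
  have hx2 := nsqH_nonneg x.2
  have hy1 := nsqH_nonneg y.1
  have hy2 := nsqH_nonneg y.2
  have hlam2 : 1 ≤ lam ^ 2 := one_le_pow₀ hlam
  have hmono : ord y ≤ ord x := by
    refine hord_mono x y hx hy ?_
    gcongr <;> nlinarith
  have hC1 : 1 ≤ (12 * M) ^ r := Real.one_le_rpow (by linarith) hr.le
  have hC0 : 0 ≤ (12 * M) ^ r := by positivity
  have hmax : 1 ≤ max (lam ^ (-r) * weightW d d' r jap ord x) 1 := le_max_right _ _
  simp only [weightW] at hmax ⊢
  set a := jap (Real.sqrt (nsqX x))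
  set b := jap (Real.sqrt (nsqX y))
  have ha1 : 1 ≤ a := hjap_one _
  have hb1 : 1 ≤ b := hjap_one _
  rcases le_or_gt (ord y) 0 with hneg | hpos
  · have h1 : b ^ (r * ord y) ≤ 1 :=
      Real.rpow_le_one_of_one_le_of_nonpos hb1 (mul_nonpos_of_nonneg_of_nonpos hr.le hneg)
    nlinarith
  have hcone : nsqH y.1 ≤ 4 * nsqH y.2 := by
    by_contra! hlt
    have : ord y = -1 := by
      refine hord_minus y hy ?_
      rw [Real.sqrt_le_left (by positivity), mul_pow, Real.sq_sqrt hy1]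
      linarith
    linarith
  have hR : Real.sqrt (nsqX y) * lam ≤ 6 * a := by
    have h1 : Real.sqrt (nsqX y) * lam ≤ 3 * Real.sqrt (nsqX x) := by
      refine le_of_abs_le (abs_le_of_sq_le_sq ?_ (by positivity))
      rw [mul_pow, mul_pow, nsqX, nsqX, Real.sq_sqrt (add_nonneg hy1 hy2),
        Real.sq_sqrt (add_nonneg hx1 hx2)]
      nlinarith
    linarith [hj2 (Real.sqrt (nsqX x)) (Real.sqrt_nonneg _)]
  have hR' : Real.sqrt (nsqX y) ≤ 6 * (a / lam) := by
    rw [← mul_div_assoc, le_div_iff₀ hl]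
    exact hR
  have hbM : b ≤ M * max 1 (Real.sqrt (nsqX y)) := hjM _ (Real.sqrt_nonneg _)
  have hm1 := (hord_range y hy).2
  have hxm1 := (hord_range x hx).2
  rcases le_or_gt lam 2 with hlam_le | hlam_gt
  · have hba : b ≤ 6 * M * a := by
      have : max 1 (Real.sqrt (nsqX y)) ≤ 6 * a :=
        max_le (by linarith) (by nlinarith [Real.sqrt_nonneg (nsqX y)])
      nlinarith
    refine le_trans ?_ (mul_le_mul_of_nonneg_left (le_max_left _ _) hC0)
    have hl2 : 2 ^ (-r) ≤ lam ^ (-r) :=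
      Real.rpow_le_rpow_of_nonpos hl hlam_le (by linarith)
    calc b ^ (r * ord y) ≤ b ^ (r * ord x) :=
          Real.rpow_le_rpow_of_exponent_le hb1 (by gcongr)
      _ ≤ (6 * M * a) ^ (r * ord x) :=
          Real.rpow_le_rpow (by linarith) hba (mul_nonneg hr.le (by linarith))
      _ = (6 * M) ^ (r * ord x) * a ^ (r * ord x) := Real.mul_rpow (by linarith) (by linarith)
      _ ≤ (6 * M) ^ r * a ^ (r * ord x) := by
          gcongr
          · linarith
          · nlinarith
      _ = (12 * M) ^ r * (2 ^ (-r) * a ^ (r * ord x)) := by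
          rw [← mul_assoc, Real.rpow_neg (by norm_num), ← div_eq_mul_inv,
            ← Real.div_rpow (by linarith) (by norm_num)]
          ring_nf
      _ ≤ (12 * M) ^ r * (lam ^ (-r) * a ^ (r * ord x)) := by gcongr
  · have hordx : ord x = 1 := by
      refine hord_plus x hx ?_
      rw [Real.sqrt_le_left (by positivity), mul_pow, Real.sq_sqrt hx2]
      have h4 : 4 ≤ lam ^ 2 := by nlinarith
      nlinarith
    rw [hordx, mul_one]
    have hba : b ≤ 12 * M * max (a / lam) 1 := by
      have h1 := le_max_left (a / lam) 1
      have h2 := le_max_right (a / lam) 1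
      have : max 1 (Real.sqrt (nsqX y)) ≤ 12 * max (a / lam) 1 :=
        max_le (by linarith) (by linarith)
      nlinarith
    calc b ^ (r * ord y) ≤ b ^ r := Real.rpow_le_rpow_of_exponent_le hb1 (by nlinarith)
      _ ≤ (12 * M * max (a / lam) 1) ^ r := Real.rpow_le_rpow (by linarith) hba hr.le
      _ = (12 * M) ^ r * max (a / lam) 1 ^ r :=
          Real.mul_rpow (by linarith) (le_trans zero_le_one (le_max_right _ _))
      _ ≤ (12 * M) ^ r * max (lam ^ (-r) * a ^ r) 1 := by
          gcongr
          rcases le_total (a / lam) 1 with h | h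
          · rw [max_eq_right h, Real.one_rpow]
            exact le_max_right _ _
          · rw [max_eq_left h, Real.div_rpow (by linarith) hl.le, Real.rpow_neg hl.le,
              div_eq_inv_mul]
            exact le_max_left _ _


end
end

section
/- Suppose the map F(x,z) = (f̃(x), z + τ(x)) preserves the contact form α₀, and f̃(0) = 0. Then the first and second derivatives of τ vanish at the origin: Dτ(0) = 0 and D²τ(0) = 0. -/
open MeasureTheory

noncomputable section

/-- Euclidean dot product on `ℝ^d`. -/
def dotp {d : ℕ} (a b : Fin d → ℝ) : ℝ := ∑ i, a i * b i

theorem dotp_comm {d : ℕ} (a b : Fin d → ℝ) : dotp a b = dotp b a := by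
  simp only [dotp, mul_comm]

theorem dotp_zero_left {d : ℕ} (b : Fin d → ℝ) : dotp 0 b = 0 := by
  simp [dotp]

theorem HasDerivAt.dotp {d : ℕ} {a b : ℝ → Fin d → ℝ} {a' b' : Fin d → ℝ} {t : ℝ}
    (ha : HasDerivAt a a' t) (hb : HasDerivAt b b' t) :
    HasDerivAt (fun s => _root_.dotp (a s) (b s))
      (_root_.dotp a' (b t) + _root_.dotp (a t) b') t := by
  unfold _root_.dotp
  rw [← Finset.sum_add_distrib]
  exact HasDerivAt.fun_sum fun i _ => (hasDerivAt_pi.1 ha i).mul (hasDerivAt_pi.1 hb i)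

theorem DifferentiableAt.hasDerivAt_comp_smul {E F : Type*} [NormedAddCommGroup E]
    [NormedSpace ℝ E] [NormedAddCommGroup F] [NormedSpace ℝ F] {f : E → F}
    (hf : DifferentiableAt ℝ f 0) (w : E) :
    HasDerivAt (fun t : ℝ => f (t • w)) (fderiv ℝ f 0 w) 0 := by
  have hline : HasDerivAt (fun t : ℝ => t • w) w 0 := by
    simpa using (hasDerivAt_id (0 : ℝ)).smul_const w
  have h : HasFDerivAt f (fderiv ℝ f 0) ((0 : ℝ) • w) := by
    simpa using hf.hasFDerivAt
  exact h.comp_hasDerivAt 0 hline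

theorem DifferentiableAt.hasDerivAt_clm_apply_comp_smul {E F G : Type*} [NormedAddCommGroup E]
    [NormedSpace ℝ E] [NormedAddCommGroup F] [NormedSpace ℝ F] [NormedAddCommGroup G]
    [NormedSpace ℝ G] {f : E → F →L[ℝ] G} (hf : DifferentiableAt ℝ f 0) (w : E) (v : F) :
    HasDerivAt (fun t : ℝ => f (t • w) v) (fderiv ℝ f 0 w v) 0 :=
  (ContinuousLinearMap.apply ℝ G v).hasFDerivAt.comp_hasDerivAt 0 (hf.hasDerivAt_comp_smul w)

theorem HasDerivAt.prod_fst {E F : Type*} [NormedAddCommGroup E] [NormedSpace ℝ E]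
    [NormedAddCommGroup F] [NormedSpace ℝ F] {f : ℝ → E × F} {f' : E × F} {t : ℝ}
    (h : HasDerivAt f f' t) : HasDerivAt (fun s => (f s).1) f'.1 t :=
  (ContinuousLinearMap.fst ℝ E F).hasFDerivAt.comp_hasDerivAt t h

theorem HasDerivAt.prod_snd {E F : Type*} [NormedAddCommGroup E] [NormedSpace ℝ E]
    [NormedAddCommGroup F] [NormedSpace ℝ F] {f : ℝ → E × F} {f' : E × F} {t : ℝ}
    (h : HasDerivAt f f' t) : HasDerivAt (fun s => (f s).2) f'.2 t :=
  (ContinuousLinearMap.snd ℝ E F).hasFDerivAt.comp_hasDerivAt t h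

/-- Let `F(x,z) = (f̃(x), z + τ(x))` preserve the standard contact form
`α₀ = dz − q·dp + p·dq` on `ℝ^{2d} × ℝ` (expressed explicitly through first derivatives), and
suppose `f̃(0) = 0`.  Then `Dτ(0) = 0` and `D²τ(0) = 0`. -/
theorem deriv_of_z_shift_vanishes_of_contact
    (d : ℕ) (hd : 1 ≤ d)
    (U : Set ((Fin d → ℝ) × (Fin d → ℝ))) (hU : IsOpen U) (h0 : (0 : (Fin d → ℝ) × (Fin d → ℝ)) ∈ U)
    (ftil : (Fin d → ℝ) × (Fin d → ℝ) → (Fin d → ℝ) × (Fin d → ℝ))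
    (τ : (Fin d → ℝ) × (Fin d → ℝ) → ℝ)
    (hf_smooth : ContDiffOn ℝ (⊤ : ℕ∞) ftil U) (hτ_smooth : ContDiffOn ℝ (⊤ : ℕ∞) τ U)
    (hf_inj : Set.InjOn ftil U)
    (hf0 : ftil 0 = 0)
    -- `F*α₀ = α₀`:  `Dτ_x(v) − f̃_q(x)·D(f̃_p)_x(v) + f̃_p(x)·D(f̃_q)_x(v) = −q·v_p + p·v_q`
    (hcontact : ∀ x ∈ U, ∀ v : (Fin d → ℝ) × (Fin d → ℝ),
      fderiv ℝ τ x v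
        - dotp (ftil x).1 (fderiv ℝ (fun y => (ftil y).2) x v)
        + dotp (ftil x).2 (fderiv ℝ (fun y => (ftil y).1) x v)
      = - dotp x.1 v.2 + dotp x.2 v.1) :
    fderiv ℝ τ 0 = 0 ∧ fderiv ℝ (fderiv ℝ τ) 0 = 0 := by
  have hUn : U ∈ nhds (0 : (Fin d → ℝ) × (Fin d → ℝ)) := hU.mem_nhds h0
  have hfat : ∀ x ∈ U, DifferentiableAt ℝ ftil x := fun x hx =>
    (hf_smooth.contDiffAt (hU.mem_nhds hx)).differentiableAt (by simp)
  have hfC : ContDiffAt ℝ (⊤ : ℕ∞) ftil 0 := hf_smooth.contDiffAt hUn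
  have hτC : ContDiffAt ℝ (⊤ : ℕ∞) τ 0 := hτ_smooth.contDiffAt hUn
  have hdf : DifferentiableAt ℝ (fderiv ℝ ftil) 0 :=
    (hfC.fderiv_right (m := 1) (WithTop.coe_le_coe.2 le_top)).differentiableAt (by simp)
  have hdτ : DifferentiableAt ℝ (fderiv ℝ τ) 0 :=
    (hτC.fderiv_right (m := 1) (WithTop.coe_le_coe.2 le_top)).differentiableAt (by simp)
  have hform : ∀ x ∈ U, ∀ v : (Fin d → ℝ) × (Fin d → ℝ),
      fderiv ℝ τ x v = dotp (ftil x).1 (fderiv ℝ ftil x v).2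
        - dotp (ftil x).2 (fderiv ℝ ftil x v).1 - dotp x.1 v.2 + dotp x.2 v.1 := by
    intro x hx v
    have h := hcontact x hx v
    rw [(hfat x hx).hasFDerivAt.snd.fderiv, (hfat x hx).hasFDerivAt.fst.fderiv] at h
    simp only [ContinuousLinearMap.comp_apply, ContinuousLinearMap.coe_fst',
      ContinuousLinearMap.coe_snd'] at h
    linarith
  have hsecond : ∀ w v : (Fin d → ℝ) × (Fin d → ℝ), fderiv ℝ (fderiv ℝ τ) 0 w v =
      dotp (fderiv ℝ ftil 0 w).1 (fderiv ℝ ftil 0 v).2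
        - dotp (fderiv ℝ ftil 0 w).2 (fderiv ℝ ftil 0 v).1 - dotp w.1 v.2 + dotp w.2 v.1 := by
    intro w v
    have hline : HasDerivAt (fun t : ℝ => t • w) w 0 := by
      simpa using (hasDerivAt_id (0 : ℝ)).smul_const w
    have hτ' := hdτ.hasDerivAt_clm_apply_comp_smul w v
    have hf' := (hfat 0 h0).hasDerivAt_comp_smul w
    have hdf' := hdf.hasDerivAt_clm_apply_comp_smul w v
    have hright := (((hf'.prod_fst.dotp hdf'.prod_snd).sub (hf'.prod_snd.dotp hdf'.prod_fst)).sub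
      (hline.prod_fst.dotp (hasDerivAt_const 0 v.2))).add
      (hline.prod_snd.dotp (hasDerivAt_const 0 v.1))
    have hmem : ∀ᶠ t : ℝ in nhds 0, t • w ∈ U :=
      hline.continuousAt.eventually_mem (by simpa using hUn)
    have heq := hτ'.unique (hright.congr_of_eventuallyEq
      (hmem.mono fun t ht => hform (t • w) ht v))
    simpa [hf0, dotp_zero_left] using heq
  constructor
  · ext1 <;> ext v
    all_goals simp [hform 0 h0, hf0, dotp_zero_left]
  · refine ContinuousLinearMap.ext fun w => ContinuousLinearMap.ext fun v => ?_
    have hsymm : fderiv ℝ (fderiv ℝ τ) 0 w v = fderiv ℝ (fderiv ℝ τ) 0 v w :=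
      (hτC.isSymmSndFDerivAt (by simpa using WithTop.coe_le_coe.2 (le_top : (2 : ℕ∞) ≤ ⊤))) w v
    have hwv := hsecond w v
    have hvw := hsecond v w
    rw [dotp_comm (fderiv ℝ ftil 0 v).1, dotp_comm (fderiv ℝ ftil 0 v).2,
      dotp_comm v.1, dotp_comm v.2] at hvw
    simp only [zero_apply]
    linarith

end
end
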